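/- Let β, δ, m, U, t be natural numbers satisfying both the intra-slot carry prevention condition U · (2^β − 1) < 2^(β+δ) and the inter-slot modulus constraint U · M < t, where M = ∑_{k=0}^{m−1} (2^β − 1) · 2^{k(β+δ)}. For each client u < U let w^u : Fin m → ℕ with w^u_k ≤ 2^β − 1 for all k, and let c^u = ∑_{k=0}^{m−1} w^u_k · 2^{k(β+δ)} be the packed coefficients. Let S = (∑_{u=1}^{U} c^u) mod t be the aggregated coefficient after reduction modulo the plaintext modulus. Then for every slot k < m, unpacking recovers the exact slot-wise sum: (S / 2^{k(β+δ)}) mod 2^(β+δ) = ∑_{u=1}^{U} w^u_k. -/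

import Mathlib

theorem slot_extract (B : ℕ) : ∀ (m : ℕ) (s : Fin m → ℕ), (∀ k, s k < B) →
    ∀ k : Fin m, (∑ i : Fin m, s i * B ^ (i : ℕ)) / B ^ (k : ℕ) % B = s k := by
  intro m
  induction m with
  | zero => intro s _ k; exact k.elim0
  | succ n ih =>
    intro s hs k
    have hB : 0 < B := lt_of_le_of_lt (Nat.zero_le _) (hs 0)
    have e : (∑ i : Fin (n + 1), s i * B ^ (i : ℕ))
        = s 0 + B * ∑ i : Fin n, s i.succ * B ^ (i : ℕ) := by
      rw [Fin.sum_univ_succ, Finset.mul_sum]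
      congr 1
      · simp
      · refine Finset.sum_congr rfl fun i _ => ?_
        rw [Fin.val_succ, pow_succ]; ring
    rw [e]
    refine Fin.cases ?_ (fun j => ?_) k
    · simp [Nat.mod_eq_of_lt (hs 0)]
    · rw [Fin.val_succ, pow_succ', ← Nat.div_div_eq_div_mul, Nat.add_mul_div_left _ _ hB,
        Nat.div_eq_of_lt (hs 0), zero_add]
      exact ih (fun i => s i.succ) (fun i => hs _) j

/-- **Correct aggregation and unpacking.** Under the intra-slot carry prevention
condition `U * (2^β - 1) < 2^(β+δ)` and the inter-slot modulus constraint
`U * M < t`, unpacking any slot of the aggregated coefficient (reduced mod `t`)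
recovers the exact slot-wise sum of the clients' weights. -/
theorem aggregation_unpacking_correct (β δ m U t : ℕ)
    (hcarry : U * (2 ^ β - 1) < 2 ^ (β + δ))
    (hmod : U * (∑ k : Fin m, (2 ^ β - 1) * 2 ^ ((k : ℕ) * (β + δ))) < t)
    (w : Fin U → Fin m → ℕ) (hw : ∀ u k, w u k ≤ 2 ^ β - 1)
    (c : Fin U → ℕ)
    (hc : ∀ u, c u = ∑ k : Fin m, w u k * 2 ^ ((k : ℕ) * (β + δ)))
    (S : ℕ) (hS : S = (∑ u, c u) % t) :
    ∀ k : Fin m, S / 2 ^ ((k : ℕ) * (β + δ)) % 2 ^ (β + δ) = ∑ u, w u k := by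
  have hsum : ∀ k, ∑ u, w u k ≤ U * (2 ^ β - 1) := fun k => by
    simpa using Finset.sum_le_card_nsmul Finset.univ (fun u => w u k) _ (fun u _ => hw u k)
  have hT : ∑ u, c u = ∑ k : Fin m, (∑ u, w u k) * 2 ^ ((k : ℕ) * (β + δ)) := by
    simp only [hc, Finset.sum_mul]
    exact Finset.sum_comm
  have hlt : ∑ u, c u < t := by
    refine lt_of_le_of_lt ?_ hmod
    rw [hT, Finset.mul_sum]
    refine Finset.sum_le_sum fun k _ => ?_
    rw [← mul_assoc]
    exact Nat.mul_le_mul_right _ (hsum k)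
  intro k
  rw [hS, Nat.mod_eq_of_lt hlt, hT]
  have h := slot_extract (2 ^ (β + δ)) m (fun k => ∑ u, w u k)
    (fun k => lt_of_le_of_lt (hsum k) hcarry) k
  simp only [← pow_mul, mul_comm (β + δ)] at h
  exact h
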